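/- arXiv:1103.1721 — 2 statements merged into one kernel-verified Lean document; each statement's English description precedes it below -/
import Mathlib

section
/- Let u ∈ A[t] be a polynomial with f(t) = u(t+n) − u(t), and set Ω₁ = x·y − u(e) and Ω₂ = x·y + y·x − v(e) − u(e) in S(A,f,n), where v(t) = u(t+n). Then Ω₂ = 2·Ω₁, and Ω₁ is central in S(A,f,n): it commutes with every element of S(A,f,n). -/
namespace SmithAlgebraStmt

variable (A : Type*) [CommRing A]

/-- The generator `x` of the free algebra on three generators. -/
noncomputable def gX : FreeAlgebra A (Fin 3) := FreeAlgebra.ι A 0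
/-- The generator `y` of the free algebra on three generators. -/
noncomputable def gY : FreeAlgebra A (Fin 3) := FreeAlgebra.ι A 1
/-- The generator `e` of the free algebra on three generators. -/
noncomputable def gE : FreeAlgebra A (Fin 3) := FreeAlgebra.ι A 2

/-- The defining relations of the Smith algebra `S(A,f,n)`:
`e*x − x*e = n•x`, `e*y − y*e = −n•y`, `y*x − x*y = f(e)`. -/
inductive SmithRel (n : ℕ) (f : Polynomial A) :
    FreeAlgebra A (Fin 3) → FreeAlgebra A (Fin 3) → Prop
  | ex : SmithRel n f (gE A * gX A - gX A * gE A) (n • gX A)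
  | ey : SmithRel n f (gE A * gY A - gY A * gE A) (-(n • gY A))
  | yx : SmithRel n f (gY A * gX A - gX A * gY A) (Polynomial.aeval (gE A) f)

/-- The Smith algebra `S(A,f,n)`: the quotient of the free `A`-algebra on three
generators `x, y, e` by the two-sided ideal generated by the elements
`e*x − x*e − n•x`, `e*y − y*e + n•y` and `y*x − x*y − f(e)`. -/
abbrev Smith (n : ℕ) (f : Polynomial A) := RingQuot (SmithRel A n f)

/-- The image of `x` in the Smith algebra. -/
noncomputable def x (n : ℕ) (f : Polynomial A) : Smith A n f :=
  RingQuot.mkAlgHom A (SmithRel A n f) (gX A)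
/-- The image of `y` in the Smith algebra. -/
noncomputable def y (n : ℕ) (f : Polynomial A) : Smith A n f :=
  RingQuot.mkAlgHom A (SmithRel A n f) (gY A)
/-- The image of `e` in the Smith algebra. -/
noncomputable def e (n : ℕ) (f : Polynomial A) : Smith A n f :=
  RingQuot.mkAlgHom A (SmithRel A n f) (gE A)

theorem semiconjBy_aeval {R S : Type*} [CommSemiring R] [Semiring S] [Algebra R S] {a b c : S}
    (h : SemiconjBy a b c) (p : Polynomial R) :
    SemiconjBy a (Polynomial.aeval b p) (Polynomial.aeval c p) := by
  induction p using Polynomial.induction_on' with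
  | add p q hp hq => simpa using hp.add_right hq
  | monomial k r =>
    simp only [Polynomial.aeval_monomial]
    exact SemiconjBy.mul_right (Algebra.commutes r a).symm (h.pow_right k)

theorem e_mul_x_sub (n : ℕ) (f : Polynomial A) :
    e A n f * x A n f - x A n f * e A n f = n • x A n f := by
  simpa [x, e] using RingQuot.mkAlgHom_rel A (SmithRel.ex (A := A) (n := n) (f := f))

theorem e_mul_y_sub (n : ℕ) (f : Polynomial A) :
    e A n f * y A n f - y A n f * e A n f = -(n • y A n f) := by
  simpa [y, e] using RingQuot.mkAlgHom_rel A (SmithRel.ey (A := A) (n := n) (f := f))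

theorem y_mul_x_sub (n : ℕ) (f : Polynomial A) :
    y A n f * x A n f - x A n f * y A n f = Polynomial.aeval (e A n f) f := by
  simpa [x, y, e, Polynomial.aeval_algHom_apply] using
    RingQuot.mkAlgHom_rel A (SmithRel.yx (A := A) (n := n) (f := f))

theorem semiconjBy_x (n : ℕ) (f : Polynomial A) :
    SemiconjBy (x A n f) (e A n f + n) (e A n f) := by
  have h := e_mul_x_sub A n f
  rw [nsmul_eq_mul, (Nat.cast_commute n _).eq, sub_eq_iff_eq_add'] at h
  rw [SemiconjBy, mul_add, h]

theorem semiconjBy_y (n : ℕ) (f : Polynomial A) :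
    SemiconjBy (y A n f) (e A n f) (e A n f + n) := by
  have h := e_mul_y_sub A n f
  rw [nsmul_eq_mul, sub_eq_iff_eq_add'] at h
  rw [SemiconjBy, add_mul, h, neg_add_cancel_right]

/-- An element commuting with `x`, `y` and `e` is central in the Smith algebra. -/
theorem commute_of_commute_generators {n : ℕ} {f : Polynomial A} {c : Smith A n f}
    (hx : Commute c (x A n f)) (hy : Commute c (y A n f)) (he : Commute c (e A n f))
    (w : Smith A n f) : Commute c w := by
  obtain ⟨a, rfl⟩ := RingQuot.mkAlgHom_surjective A (SmithRel A n f) w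
  induction a using FreeAlgebra.induction with
  | grade0 r => simpa using Algebra.commute_algebraMap_right r c
  | grade1 i =>
    fin_cases i
    · exact hx
    · exact hy
    · exact he
  | mul a b ha hb => simpa using ha.mul_right hb
  | add a b ha hb => simpa using ha.add_right hb

/-- Given `u ∈ A[t]` with `f(t) = u(t+n) − u(t)`, setting
`Ω₁ = x·y − u(e)` and `Ω₂ = x·y + y·x − v(e) − u(e)` (where `v(t) = u(t+n)`),
one has `Ω₂ = 2·Ω₁`, and `Ω₁` is central in `S(A,f,n)`. -/
theorem stmt_5 {A : Type*} [CommRing A] [IsDomain A] [Algebra ℂ A]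
    (n : ℕ) (hn : 0 < n) (f : Polynomial A) (u : Polynomial A)
    (hu : f = u.comp (Polynomial.X + Polynomial.C (n : A)) - u) :
    (x A n f * y A n f + y A n f * x A n f -
        Polynomial.aeval (e A n f) (u.comp (Polynomial.X + Polynomial.C (n : A))) -
        Polynomial.aeval (e A n f) u =
      2 * (x A n f * y A n f - Polynomial.aeval (e A n f) u)) ∧
    (∀ w : Smith A n f,
        (x A n f * y A n f - Polynomial.aeval (e A n f) u) * w =
          w * (x A n f * y A n f - Polynomial.aeval (e A n f) u)) := by
  have hv : Polynomial.aeval (e A n f) (u.comp (Polynomial.X + Polynomial.C (n : A))) =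
      Polynomial.aeval (e A n f + n) u := by
    simp [Polynomial.aeval_comp]
  have hyx : y A n f * x A n f =
      x A n f * y A n f + (Polynomial.aeval (e A n f + n) u - Polynomial.aeval (e A n f) u) := by
    rw [← hv, ← map_sub, ← hu, ← y_mul_x_sub]
    abel
  have hΩ : x A n f * y A n f - Polynomial.aeval (e A n f) u =
      y A n f * x A n f - Polynomial.aeval (e A n f + n) u := by
    rw [hyx]
    abel
  refine ⟨?_, commute_of_commute_generators A ?_ ?_ ?_⟩
  · rw [hv, hyx, two_mul]
    abel
  · have h := (semiconjBy_aeval (semiconjBy_x A n f) u).eq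
    rw [Commute, SemiconjBy]
    nth_rewrite 2 [hΩ]
    rw [sub_mul, mul_sub, h, mul_assoc]
  · have h := (semiconjBy_aeval (semiconjBy_y A n f) u).eq
    rw [Commute, SemiconjBy]
    nth_rewrite 1 [hΩ]
    rw [sub_mul, mul_sub, h, mul_assoc]
  · have hxy : Commute (x A n f * y A n f) (e A n f) :=
      (semiconjBy_x A n f).mul_left (semiconjBy_y A n f)
    exact hxy.sub_left (semiconjBy_aeval (Commute.refl (e A n f)) u).symm

end SmithAlgebraStmt
end

section
/- Let u ∈ A[t] be a polynomial with f(t) = u(t+n) − u(t), and set Ω₁ = x·y − u(e) in S(A,f,n). Then the center of S(A,f,n) is exactly the A-subalgebra A[Ω₁] generated by Ω₁, and A[Ω₁] is a polynomial algebra over A: the A-algebra homomorphism A[t] → S(A,f,n) sending t to Ω₁ is injective, i.e. the powers Ω₁^i (i ∈ ℕ) are A-linearly independent. -/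
namespace SmithAlgebraStmt

variable (A : Type*) [CommRing A]

section Auxiliary

open Polynomial

variable {A}

theorem smith_induction {n : ℕ} {f : A[X]} {motive : Smith A n f → Prop}
    (algebraMap : ∀ a, motive (algebraMap A _ a))
    (x : motive (x A n f)) (y : motive (y A n f)) (e : motive (e A n f))
    (add : ∀ a b, motive a → motive b → motive (a + b))
    (mul : ∀ a b, motive a → motive b → motive (a * b)) (z : Smith A n f) : motive z := by
  obtain ⟨w, rfl⟩ := RingQuot.mkAlgHom_surjective A (SmithRel A n f) z
  induction w using FreeAlgebra.induction with
  | grade0 r => simpa only [AlgHom.commutes] using algebraMap r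
  | grade1 i =>
    fin_cases i
    · exact x
    · exact y
    · exact e
  | mul a b ha hb => simpa only [map_mul] using mul _ _ ha hb
  | add a b ha hb => simpa only [map_add] using add _ _ ha hb

theorem e_mul_x (n : ℕ) (f : A[X]) :
    e A n f * x A n f = x A n f * e A n f + n * x A n f := by
  have h := RingQuot.mkAlgHom_rel A (SmithRel.ex (A := A) (n := n) (f := f))
  simp only [map_sub, map_mul, nsmul_eq_mul, map_natCast] at h
  exact sub_eq_iff_eq_add'.mp h

theorem e_mul_y (n : ℕ) (f : A[X]) :
    e A n f * y A n f = y A n f * e A n f - n * y A n f := by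
  have h := RingQuot.mkAlgHom_rel A (SmithRel.ey (A := A) (n := n) (f := f))
  simp only [map_sub, map_mul, map_neg, nsmul_eq_mul, map_natCast] at h
  rw [sub_eq_add_neg]
  exact sub_eq_iff_eq_add'.mp h

theorem y_mul_x (n : ℕ) (f : A[X]) :
    y A n f * x A n f = x A n f * y A n f + aeval (e A n f) f := by
  have h := RingQuot.mkAlgHom_rel A (SmithRel.yx (A := A) (n := n) (f := f))
  simp only [map_sub, map_mul, ← aeval_algHom_apply] at h
  exact sub_eq_iff_eq_add'.mp h

/-- An element which shifts the image of the variable under a ring homomorphism `φ` shifts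
the image of every polynomial. -/
theorem mul_map_eq_map_comp_mul {R S : Type*} [CommRing R] [Ring S] (φ : R[X] →+* S) (a : S)
    (c : R) (hC : ∀ r, a * φ (C r) = φ (C r) * a) (hX : a * φ X = φ (X + C c) * a) (p : R[X]) :
    a * φ p = φ (p.comp (X + C c)) * a := by
  induction p using Polynomial.induction_on with
  | C r => simpa using hC r
  | add p q hp hq => simp only [map_add, add_comp, mul_add, add_mul, hp, hq]
  | monomial k r h =>
    rw [pow_succ, ← mul_assoc, mul_comp, X_comp, map_mul φ _ X, ← mul_assoc, h, mul_assoc,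
      hX, map_mul, mul_assoc]

theorem x_mul_aeval (n : ℕ) (f p : A[X]) :
    x A n f * aeval (e A n f) p = aeval (e A n f) (p.comp (X + C (-(n : A)))) * x A n f := by
  refine mul_map_eq_map_comp_mul (aeval (e A n f) : A[X] →ₐ[A] Smith A n f).toRingHom _ _
    (fun r => ?_) ?_ p
  · simpa using (Algebra.commutes r (x A n f)).symm
  · have h : x A n f * e A n f = (e A n f - n) * x A n f := by
      rw [sub_mul, e_mul_x, add_sub_cancel_right]
    simpa [sub_eq_add_neg] using h

theorem y_mul_aeval (n : ℕ) (f p : A[X]) :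
    y A n f * aeval (e A n f) p = aeval (e A n f) (p.comp (X + C (n : A))) * y A n f := by
  refine mul_map_eq_map_comp_mul (aeval (e A n f) : A[X] →ₐ[A] Smith A n f).toRingHom _ _
    (fun r => ?_) ?_ p
  · simpa using (Algebra.commutes r (y A n f)).symm
  · simp [add_mul, e_mul_y]

/-- The Casimir element `x * y - u(e)`. -/
noncomputable abbrev casimir (n : ℕ) (f u : A[X]) : Smith A n f :=
  x A n f * y A n f - aeval (e A n f) u

theorem casimir_commute_e (n : ℕ) (f u : A[X]) : Commute (casimir n f u) (e A n f) := by
  refine Commute.sub_left ?_ ?_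
  · have h : e A n f * (x A n f * y A n f) = x A n f * y A n f * e A n f := by
      rw [← mul_assoc, e_mul_x, add_mul, mul_assoc, e_mul_y, mul_sub, ← mul_assoc,
        ← mul_assoc, (Nat.cast_commute n (x A n f)).eq]
      abel
    exact h.symm
  · simpa only [aeval_X] using (Commute.all u X).map (aeval (e A n f) : A[X] →ₐ[A] Smith A n f)

theorem casimir_commute_x {n : ℕ} {f u : A[X]} (hu : f = u.comp (X + C (n : A)) - u) :
    Commute (casimir n f u) (x A n f) := by
  have h := x_mul_aeval n f (u.comp (X + C (n : A)))
  rw [comp_assoc] at h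
  simp only [add_comp, X_comp, C_comp, add_assoc, ← C_add, neg_add_cancel, C_0, add_zero,
    comp_X] at h
  have hf : aeval (e A n f) f = aeval (e A n f) (u.comp (X + C (n : A))) - aeval (e A n f) u := by
    rw [← map_sub, ← hu]
  change (_ - _) * _ = _ * (_ - _)
  rw [sub_mul, mul_assoc, y_mul_x, mul_add, hf, mul_sub, mul_sub, ← h]
  abel

theorem casimir_commute_y {n : ℕ} {f u : A[X]} (hu : f = u.comp (X + C (n : A)) - u) :
    Commute (casimir n f u) (y A n f) := by
  have hf : aeval (e A n f) f = aeval (e A n f) (u.comp (X + C (n : A))) - aeval (e A n f) u := by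
    rw [← map_sub, ← hu]
  change (_ - _) * _ = _ * (_ - _)
  rw [mul_sub, ← mul_assoc, y_mul_x, add_mul, hf, sub_mul, sub_mul, y_mul_aeval]
  abel

theorem casimir_mem_center {n : ℕ} {f u : A[X]} (hu : f = u.comp (X + C (n : A)) - u) :
    casimir n f u ∈ Subalgebra.center A (Smith A n f) := by
  rw [Subalgebra.mem_center_iff]
  intro z
  change Commute z _
  induction z using smith_induction with
  | algebraMap a => exact Algebra.commutes a _
  | x => exact (casimir_commute_x hu).symm
  | y => exact (casimir_commute_y hu).symm
  | e => exact (casimir_commute_e n f u).symm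
  | add a b ha hb => exact ha.add_left hb
  | mul a b ha hb => exact ha.mul_left hb

/-- Evaluation of the outer variable at `e` and of the inner variable at the Casimir element. -/
noncomputable def evalCasimirE (n : ℕ) (f u : A[X]) : A[X][X] →+* Smith A n f :=
  eval₂RingHom' (aeval (casimir n f u) : A[X] →ₐ[A] Smith A n f).toRingHom (e A n f) fun p => by
    induction p using Polynomial.induction_on with
    | C r => simpa [Commute, SemiconjBy] using Algebra.commutes r (e A n f)
    | add p q hp hq => simpa only [map_add] using hp.add_left hq
    | monomial k r h =>
      rw [pow_succ, ← mul_assoc, map_mul]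
      refine h.mul_left ?_
      simpa using casimir_commute_e n f u

@[simp] theorem evalCasimirE_C (n : ℕ) (f u p : A[X]) :
    evalCasimirE n f u (C p) = aeval (casimir n f u) p := by
  simp [evalCasimirE, eval₂RingHom']

@[simp] theorem evalCasimirE_X (n : ℕ) (f u : A[X]) :
    evalCasimirE n f u X = e A n f := by
  simp [evalCasimirE, eval₂RingHom']

theorem evalCasimirE_map_C (n : ℕ) (f u p : A[X]) :
    evalCasimirE n f u (p.map C) = aeval (e A n f) p := by
  induction p using Polynomial.induction_on with
  | C r => simp
  | add p q hp hq => simp [hp, hq]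
  | monomial k r h => simp

theorem x_mul_evalCasimirE {n : ℕ} {f u : A[X]} (hu : f = u.comp (X + C (n : A)) - u)
    (q : A[X][X]) : x A n f * evalCasimirE n f u q =
      evalCasimirE n f u (q.comp (X + C (-(n : A[X])))) * x A n f := by
  refine mul_map_eq_map_comp_mul _ _ _ (fun r => ?_) ?_ q
  · have h : aeval (casimir n f u) r ∈ Subalgebra.center A (Smith A n f) :=
      Algebra.adjoin_le (Set.singleton_subset_iff.mpr (casimir_mem_center hu))
        (aeval_mem_adjoin_singleton A _)
    simpa using Subalgebra.mem_center_iff.mp h (x A n f)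
  · have h : x A n f * e A n f = (e A n f - n) * x A n f := by
      rw [sub_mul, e_mul_x, add_sub_cancel_right]
    simpa [sub_eq_add_neg] using h

theorem y_mul_evalCasimirE {n : ℕ} {f u : A[X]} (hu : f = u.comp (X + C (n : A)) - u)
    (q : A[X][X]) : y A n f * evalCasimirE n f u q =
      evalCasimirE n f u (q.comp (X + C (n : A[X]))) * y A n f := by
  refine mul_map_eq_map_comp_mul _ _ _ (fun r => ?_) ?_ q
  · have h : aeval (casimir n f u) r ∈ Subalgebra.center A (Smith A n f) :=
      Algebra.adjoin_le (Set.singleton_subset_iff.mpr (casimir_mem_center hu))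
        (aeval_mem_adjoin_singleton A _)
    simpa using Subalgebra.mem_center_iff.mp h (y A n f)
  · simp [add_mul, e_mul_y]

/-- The standard element of weight `n * k`: a power of `x` or of `y`. -/
noncomputable def weightVector (n : ℕ) (f : A[X]) : ℤ → Smith A n f
  | Int.ofNat k => x A n f ^ k
  | Int.negSucc k => y A n f ^ (k + 1)

theorem weightVector_natCast (n : ℕ) (f : A[X]) (k : ℕ) :
    weightVector n f k = x A n f ^ k := rfl

theorem weightVector_neg_natCast (n : ℕ) (f : A[X]) (k : ℕ) :
    weightVector n f (-(k : ℤ)) = y A n f ^ k := by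
  cases k with
  | zero => simpa using weightVector_natCast n f 0
  | succ k => rfl

/-- The sum of `q k * weightVector k`, with the coefficients `q k` read in `A[Ω, e]`. -/
noncomputable def weightSum (n : ℕ) (f u : A[X]) : (ℤ →₀ A[X][X]) →+ Smith A n f :=
  Finsupp.liftAddHom fun k =>
    (AddMonoidHom.mulRight (weightVector n f k)).comp (evalCasimirE n f u).toAddMonoidHom

theorem weightSum_apply (n : ℕ) (f u : A[X]) (q : ℤ →₀ A[X][X]) :
    weightSum n f u q = q.sum fun k p => evalCasimirE n f u p * weightVector n f k := rfl

theorem evalCasimirE_mul_weightVector_mem (n : ℕ) (f u : A[X]) (p : A[X][X]) (k : ℤ) :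
    evalCasimirE n f u p * weightVector n f k ∈ AddMonoidHom.mrange (weightSum n f u) :=
  ⟨Finsupp.single k p, by rw [weightSum_apply, Finsupp.sum_single_index (by simp)]⟩

theorem mul_mem_mrange_weightSum {n : ℕ} {f u : A[X]} {a : Smith A n f}
    (hx : ∀ p k, a * (evalCasimirE n f u p * x A n f ^ k) ∈ AddMonoidHom.mrange (weightSum n f u))
    (hy : ∀ p k, a * (evalCasimirE n f u p * y A n f ^ (k + 1)) ∈
      AddMonoidHom.mrange (weightSum n f u))
    {z : Smith A n f} (hz : z ∈ AddMonoidHom.mrange (weightSum n f u)) :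
    a * z ∈ AddMonoidHom.mrange (weightSum n f u) := by
  obtain ⟨q, rfl⟩ := hz
  rw [weightSum_apply, Finsupp.sum, Finset.mul_sum]
  refine sum_mem fun k _ => ?_
  cases k with
  | ofNat k => exact hx _ k
  | negSucc k => exact hy _ k

theorem weightSum_surjective {n : ℕ} {f u : A[X]} (hu : f = u.comp (X + C (n : A)) - u) :
    Function.Surjective (weightSum n f u) := by
  have hmx : ∀ p (k : ℕ), evalCasimirE n f u p * x A n f ^ k ∈
      AddMonoidHom.mrange (weightSum n f u) :=
    fun p k => evalCasimirE_mul_weightVector_mem n f u p k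
  have hmy : ∀ p (k : ℕ), evalCasimirE n f u p * y A n f ^ k ∈
      AddMonoidHom.mrange (weightSum n f u) :=
    fun p k => weightVector_neg_natCast n f k ▸ evalCasimirE_mul_weightVector_mem n f u p (-k)
  have hxy : x A n f * y A n f = evalCasimirE n f u (C X + u.map C) := by
    simp [evalCasimirE_map_C]
  have hyx : y A n f * x A n f = evalCasimirE n f u (C X + u.map C + f.map C) := by
    rw [map_add, ← hxy, evalCasimirE_map_C, y_mul_x]
  have hmul : ∀ a z : Smith A n f, z ∈ AddMonoidHom.mrange (weightSum n f u) →
      a * z ∈ AddMonoidHom.mrange (weightSum n f u) := by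
    intro a
    induction a using smith_induction with
    | algebraMap a =>
      have ha : algebraMap A _ a = evalCasimirE n f u (C (C a)) := by simp
      intro z
      refine mul_mem_mrange_weightSum (fun p k => ?_) fun p k => ?_ <;>
        rw [ha, ← mul_assoc, ← map_mul]
      exacts [hmx _ _, hmy _ _]
    | x =>
      intro z
      refine mul_mem_mrange_weightSum (fun p k => ?_) fun p k => ?_ <;>
        rw [← mul_assoc, x_mul_evalCasimirE hu, mul_assoc]
      · rw [← pow_succ']
        exact hmx _ _
      · rw [pow_succ', ← mul_assoc (x A n f), hxy, ← mul_assoc, ← map_mul]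
        exact hmy _ _
    | y =>
      intro z
      refine mul_mem_mrange_weightSum (fun p k => ?_) fun p k => ?_ <;>
        rw [← mul_assoc, y_mul_evalCasimirE hu, mul_assoc]
      · cases k with
        | zero => simpa using hmy _ 1
        | succ k =>
          rw [pow_succ', ← mul_assoc (y A n f), hyx, ← mul_assoc, ← map_mul]
          exact hmx _ _
      · rw [← pow_succ']
        exact hmy _ _
    | e =>
      intro z
      refine mul_mem_mrange_weightSum (fun p k => ?_) fun p k => ?_ <;>
        rw [← evalCasimirE_X n f u, ← mul_assoc, ← map_mul]
      exacts [hmx _ _, hmy _ _]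
    | add a b ha hb =>
      intro z hz
      rw [add_mul]
      exact add_mem (ha z hz) (hb z hz)
    | mul a b ha hb =>
      intro z hz
      rw [mul_assoc]
      exact ha _ (hb z hz)
  intro z
  simpa using hmul z 1 (by simpa using hmx 1 0)

/-- The action of `x` on sequences: the shift. -/
noncomputable def repX (A : Type*) [CommRing A] : Module.End A[X] (ℤ → A[X]) :=
  LinearMap.funLeft A[X] A[X] fun k => k - 1

/-- The action of `e` on sequences: multiplication by `n * k` in position `k`. -/
noncomputable def repE (A : Type*) [CommRing A] (n : ℕ) : Module.End A[X] (ℤ → A[X]) :=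
  LinearMap.pi fun k => C ((n : A) * (k : A)) • LinearMap.proj k

/-- The action of `y` on sequences. -/
noncomputable def repY (n : ℕ) (u : A[X]) : Module.End A[X] (ℤ → A[X]) :=
  LinearMap.pi fun k => (X + C (u.eval ((n : A) * ((k + 1 : ℤ) : A)))) • LinearMap.proj (k + 1)

@[simp] theorem repX_apply (v : ℤ → A[X]) (k : ℤ) : repX A v k = v (k - 1) := rfl

@[simp] theorem repE_apply (n : ℕ) (v : ℤ → A[X]) (k : ℤ) :
    repE A n v k = C ((n : A) * (k : A)) * v k := rfl

@[simp] theorem repY_apply (n : ℕ) (u : A[X]) (v : ℤ → A[X]) (k : ℤ) :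
    repY n u v k = (X + C (u.eval ((n : A) * ((k + 1 : ℤ) : A)))) * v (k + 1) := rfl

theorem aeval_repE_apply (n : ℕ) (p : A[X]) (v : ℤ → A[X]) (k : ℤ) :
    aeval (repE A n) p v k = C (p.eval ((n : A) * (k : A))) * v k := by
  induction p using Polynomial.induction_on generalizing v with
  | C r => simp [Module.algebraMap_end_apply, smul_eq_C_mul]
  | add p q hp hq => simp [hp, hq, add_mul]
  | monomial m r h =>
    rw [pow_succ, ← mul_assoc, map_mul, Module.End.mul_apply, h, aeval_X, repE_apply,
      eval_mul_X, C_mul (a := eval _ _), mul_assoc]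

/-- The representation of the Smith algebra on sequences of polynomials in the Casimir element. -/
noncomputable def rep {n : ℕ} {f u : A[X]} (hu : f = u.comp (X + C (n : A)) - u) :
    Smith A n f →ₐ[A] Module.End A[X] (ℤ → A[X]) :=
  RingQuot.liftAlgHom A ⟨FreeAlgebra.lift A ![repX A, repY n u, repE A n], by
    intro a b h
    cases h with
    | ex =>
      simp only [gE, gX, map_sub, map_mul, map_nsmul, FreeAlgebra.lift_ι_apply]
      refine LinearMap.ext fun v => funext fun k => ?_
      simp
      ring
    | ey =>
      simp only [gE, gY, map_sub, map_mul, map_nsmul, map_neg, FreeAlgebra.lift_ι_apply]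
      refine LinearMap.ext fun v => funext fun k => ?_
      simp
      ring
    | yx =>
      simp only [gE, gX, gY, map_sub, map_mul, ← aeval_algHom_apply, FreeAlgebra.lift_ι_apply]
      refine LinearMap.ext fun v => funext fun k => ?_
      simp [aeval_repE_apply, hu, mul_add]
      ring⟩

section Rep

variable {n : ℕ} {f u : A[X]} (hu : f = u.comp (X + C (n : A)) - u)

@[simp] theorem rep_x : rep hu (x A n f) = repX A := by
  simp [rep, x, gX]

@[simp] theorem rep_y : rep hu (y A n f) = repY n u := by
  simp [rep, y, gY]

@[simp] theorem rep_e : rep hu (e A n f) = repE A n := by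
  simp [rep, e, gE]

theorem rep_casimir_apply (v : ℤ → A[X]) (k : ℤ) :
    rep hu (casimir n f u) v k = X * v k := by
  simp [← aeval_algHom_apply, aeval_repE_apply, add_mul]

theorem rep_aeval_casimir_apply (p : A[X]) (v : ℤ → A[X]) (k : ℤ) :
    rep hu (aeval (casimir n f u) p) v k = p * v k := by
  induction p using Polynomial.induction_on generalizing v with
  | C r => simp [Module.algebraMap_end_apply, smul_eq_C_mul]
  | add p q hp hq => simp only [map_add, LinearMap.add_apply, Pi.add_apply, hp, hq, add_mul]
  | monomial m r h =>
    rw [pow_succ, ← mul_assoc, map_mul _ _ X, map_mul, Module.End.mul_apply, h, aeval_X,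
      rep_casimir_apply, ← mul_assoc]

theorem rep_evalCasimirE_apply (q : A[X][X]) (v : ℤ → A[X]) (k : ℤ) :
    rep hu (evalCasimirE n f u q) v k = q.eval (C ((n : A) * (k : A))) * v k := by
  induction q using Polynomial.induction_on generalizing v with
  | C r => rw [evalCasimirE_C, rep_aeval_casimir_apply, eval_C]
  | add p q hp hq =>
    simp only [map_add, LinearMap.add_apply, Pi.add_apply, hp, hq, add_mul, eval_add]
  | monomial m r h =>
    rw [pow_succ, ← mul_assoc, map_mul, map_mul, Module.End.mul_apply, h, evalCasimirE_X,
      rep_e, repE_apply, eval_mul_X, mul_assoc]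

theorem exists_rep_weightVector_apply [IsDomain A] (k j : ℤ) :
    ∃ d : A[X], d ≠ 0 ∧ ∀ v, rep hu (weightVector n f k) v j = d * v (j - k) := by
  obtain ⟨k, rfl | rfl⟩ := k.eq_nat_or_neg
  · rw [weightVector_natCast]
    refine ⟨1, one_ne_zero, ?_⟩
    induction k with
    | zero => simp
    | succ k ih =>
      intro v
      rw [pow_succ, map_mul, Module.End.mul_apply, ih, rep_x, repX_apply]
      congr 2
      push_cast
      ring
  · rw [weightVector_neg_natCast]
    induction k with
    | zero => exact ⟨1, one_ne_zero, by simp⟩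
    | succ k ih =>
      obtain ⟨d, hd, h⟩ := ih
      refine ⟨d * (X + C (u.eval ((n : A) * ((j - -(k : ℤ) + 1 : ℤ) : A)))),
        mul_ne_zero hd (X_add_C_ne_zero _), fun v => ?_⟩
      rw [pow_succ, map_mul, Module.End.mul_apply, h, rep_y, repY_apply, mul_assoc]
      congr 3
      push_cast
      ring

theorem exists_rep_weightSum_single_apply [IsDomain A] (q : ℤ →₀ A[X][X]) (j k : ℤ) :
    ∃ d : A[X], d ≠ 0 ∧ rep hu (weightSum n f u q) (Pi.single (j - k) 1) j =
      (q k).eval (C ((n : A) * (j : A))) * d := by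
  obtain ⟨d, hd, h⟩ := exists_rep_weightVector_apply hu k j
  refine ⟨d, hd, ?_⟩
  rw [weightSum_apply, Finsupp.sum, map_sum, LinearMap.sum_apply, Finset.sum_apply,
    Finset.sum_eq_single k]
  · rw [map_mul, Module.End.mul_apply, rep_evalCasimirE_apply, h]
    simp
  · intro m _ hm
    obtain ⟨_, _, h₂⟩ := exists_rep_weightVector_apply hu m j
    rw [map_mul, Module.End.mul_apply, rep_evalCasimirE_apply, h₂,
      Pi.single_eq_of_ne (by lia), mul_zero, mul_zero]
  · intro hk
    simp [Finsupp.notMem_support_iff.mp hk]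

end Rep

theorem eq_zero_of_eval_natCast_mul_intCast [IsDomain A] [CharZero A] {n : ℕ} (hn : 0 < n)
    {q : A[X][X]} (h : ∀ j : ℤ, q.eval (C ((n : A) * (j : A))) = 0) : q = 0 := by
  refine eq_zero_of_infinite_isRoot q (Set.Infinite.mono (Set.range_subset_iff.mpr h)
    (Set.infinite_range_of_injective fun i j hij => ?_))
  simpa [hn.ne'] using hij

theorem mem_adjoin_casimir_of_mem_center [IsDomain A] [CharZero A] {n : ℕ} (hn : 0 < n)
    {f u : A[X]} (hu : f = u.comp (X + C (n : A)) - u) {z : Smith A n f}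
    (hz : z ∈ Subalgebra.center A (Smith A n f)) : z ∈ Algebra.adjoin A {casimir n f u} := by
  rw [Subalgebra.mem_center_iff] at hz
  obtain ⟨q, rfl⟩ := weightSum_surjective hu z
  have hq : ∀ k ≠ 0, q k = 0 := by
    intro k hk
    refine eq_zero_of_eval_natCast_mul_intCast hn fun j => ?_
    obtain ⟨d, hd, h⟩ := exists_rep_weightSum_single_apply hu q j k
    have he := congrFun (LinearMap.congr_fun (congrArg (rep hu) (hz (e A n f)))
      (Pi.single (j - k) 1)) j
    have hs : repE A n (Pi.single (j - k) 1) =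
        C ((n : A) * ((j - k : ℤ) : A)) • Pi.single (j - k) (1 : A[X]) := by
      funext i
      by_cases hi : i = j - k
      · subst hi; simp
      · simp [Pi.single_eq_of_ne hi]
    rw [map_mul, map_mul, Module.End.mul_apply, Module.End.mul_apply, rep_e, repE_apply, hs,
      map_smul, Pi.smul_apply, smul_eq_mul, h, ← sub_eq_zero, ← sub_mul, ← C_sub, ← mul_sub,
      ← Int.cast_sub, sub_sub_cancel] at he
    simpa [hn.ne', hk, hd] using he
  have hsum : weightSum n f u q = evalCasimirE n f u (q 0) := by
    rw [weightSum_apply, Finsupp.sum, Finset.sum_eq_single 0]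
    · rw [show weightVector n f 0 = 1 from pow_zero (x A n f), mul_one]
    · intro k _ hk
      simp [hq k hk]
    · intro h
      simp [Finsupp.notMem_support_iff.mp h]
  rw [hsum] at hz ⊢
  have hstep : ∀ j : ℤ, (q 0).eval (C ((n : A) * ((j - 1 : ℤ) : A))) =
      (q 0).eval (C ((n : A) * (j : A))) := by
    intro j
    have hx := congrFun (LinearMap.congr_fun (congrArg (rep hu) (hz (x A n f))) 1) j
    simpa only [map_mul, Module.End.mul_apply, rep_evalCasimirE_apply, rep_x, repX_apply,
      Pi.one_apply, mul_one] using hx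
  have hconst : q 0 = C ((q 0).eval 0) := by
    rw [← sub_eq_zero]
    refine eq_zero_of_eval_natCast_mul_intCast hn fun j => ?_
    rw [eval_sub, eval_C, sub_eq_zero]
    induction j using Int.induction_on with
    | zero => simp
    | succ j ih => rw [← hstep, add_sub_cancel_right, ih]
    | pred j ih => rw [hstep, ih]
  rw [hconst, evalCasimirE_C]
  exact aeval_mem_adjoin_singleton A _

end Auxiliary

/-- Given `u ∈ A[t]` with `f(t) = u(t+n) − u(t)` and
`Ω₁ = x·y − u(e)`, the center of `S(A,f,n)` is exactly the `A`-subalgebra generated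
by `Ω₁`, and the `A`-algebra map `A[t] → S(A,f,n)`, `t ↦ Ω₁`, is injective
(so `A[Ω₁]` is a polynomial algebra over `A`). -/
theorem stmt_6 {A : Type*} [CommRing A] [IsDomain A] [Algebra ℂ A]
    (n : ℕ) (hn : 0 < n) (f : Polynomial A) (u : Polynomial A)
    (hu : f = u.comp (Polynomial.X + Polynomial.C (n : A)) - u) :
    Subalgebra.center A (Smith A n f) =
      Algebra.adjoin A {x A n f * y A n f - Polynomial.aeval (e A n f) u} ∧
    Function.Injective
      (fun P : Polynomial A =>
        Polynomial.aeval (x A n f * y A n f - Polynomial.aeval (e A n f) u) P) := by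
  have : CharZero A := charZero_of_injective_algebraMap (algebraMap ℂ A).injective
  refine ⟨le_antisymm (fun z hz => mem_adjoin_casimir_of_mem_center hn hu hz)
    (Algebra.adjoin_le (Set.singleton_subset_iff.mpr (casimir_mem_center hu))), ?_⟩
  intro P Q h
  simpa [rep_aeval_casimir_apply] using
    congrFun (LinearMap.congr_fun (congrArg (rep hu) h) 1) 0

end SmithAlgebraStmt
end
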